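/- arXiv:1401.0427 — 3 statements merged into one kernel-verified Lean document; each statement's English description precedes it below -/
import Mathlib

section
/- Let d, q, N be positive integers, let v_j ∈ ℝ^d for 0 ≤ j ≤ q−1 be given velocities, let τ > 0, and let h_j : ℝ^N → ℝ be convex differentiable functions. Let f_j : ℝ × ℝ^d → ℝ^N and f_j^eq : ℝ × ℝ^d → ℝ^N be differentiable functions and φ : ℝ × ℝ^d → ℝ^N a function such that at every point (t,x): (i) ∇h_j(f_j^eq(t,x)) = φ(t,x) for every j (Legendre duality at equilibrium), (ii) Σ_{j=0}^{q−1} f_j^eq(t,x) = Σ_{j=0}^{q−1} f_j(t,x) (conservation at equilibrium), and (iii) each f_j satisfies the discrete-velocity BGK transport equation ∂_t f_j + Σ_{α=1}^d v_j^α ∂_{x_α} f_j = (1/τ)(f_j^eq − f_j). Then at every point (t,x) the microscopic entropy H(t,x) := Σ_{j=0}^{q−1} h_j(f_j(t,x)) satisfies the entropy dissipation inequality ∂_t H + Σ_{α=1}^d ∂_{x_α} ( Σ_{j=0}^{q−1} v_j^α h_j(f_j) ) ≤ 0. -/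
/-- First-order characterization of convexity: a convex function lies above its tangent. -/
theorem ConvexOn.fderiv_sub_le {E : Type*} [NormedAddCommGroup E] [NormedSpace ℝ E]
    {g : E → ℝ} (hg : ConvexOn ℝ Set.univ g) {g' : E →L[ℝ] ℝ} {x : E}
    (hx : HasFDerivAt g g' x) (y : E) : g' (y - x) ≤ g y - g x := by
  have hline : HasDerivAt (g ∘ AffineMap.lineMap x y) (g' (y - x)) (0 : ℝ) := by
    refine HasFDerivAt.comp_hasDerivAt _ ?_ AffineMap.hasDerivAt_lineMap
    simpa using hx
  have hconv : ConvexOn ℝ Set.univ (g ∘ AffineMap.lineMap (k := ℝ) x y) := by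
    simpa using hg.comp_affineMap (AffineMap.lineMap (k := ℝ) x y)
  simpa [slope_def_field] using
    hconv.le_slope_of_hasDerivAt (Set.mem_univ 0) (Set.mem_univ 1) one_pos hline

/-- The derivative of a differentiable convex function is a monotone operator. -/
theorem ConvexOn.fderiv_apply_sub_le {E : Type*} [NormedAddCommGroup E] [NormedSpace ℝ E]
    {g : E → ℝ} (hg : ConvexOn ℝ Set.univ g) (hd : Differentiable ℝ g) (x y : E) :
    fderiv ℝ g x (y - x) ≤ fderiv ℝ g y (y - x) := by
  have hx := hg.fderiv_sub_le (hd x).hasFDerivAt y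
  have hy := hg.fderiv_sub_le (hd y).hasFDerivAt x
  rw [← neg_sub y x, map_neg] at hy
  linarith

/-- H-theorem for the continuous-in-time-and-space discrete-velocity BGK model:
if each potential `h j` is convex and differentiable, the equilibria satisfy the
Legendre duality `∇h_j(f_j^eq) = φ` and the conservation `∑ f_j^eq = ∑ f_j`, and each
distribution satisfies the BGK transport equation, then the microscopic entropy
`H = ∑ h_j(f_j)` satisfies the entropy dissipation inequality. -/
theorem bgk_H_theorem
    (d q N : ℕ) (hd : 0 < d) (hq : 0 < q) (hN : 0 < N)
    (v : Fin q → Fin d → ℝ) (τ : ℝ) (hτ : 0 < τ)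
    (h : Fin q → EuclideanSpace ℝ (Fin N) → ℝ)
    (hconv : ∀ j, ConvexOn ℝ Set.univ (h j))
    (hdiff : ∀ j, Differentiable ℝ (h j))
    (f feq : Fin q → (ℝ × (Fin d → ℝ)) → EuclideanSpace ℝ (Fin N))
    (hf : ∀ j, Differentiable ℝ (f j))
    (hfeq : ∀ j, Differentiable ℝ (feq j))
    (φ : (ℝ × (Fin d → ℝ)) → EuclideanSpace ℝ (Fin N))
    (hLegendre : ∀ j p, gradient (h j) (feq j p) = φ p)
    (hcons : ∀ p : ℝ × (Fin d → ℝ), ∑ j, feq j p = ∑ j, f j p)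
    (hBGK : ∀ j, ∀ p : ℝ × (Fin d → ℝ),
      fderiv ℝ (f j) p (1, 0)
        + ∑ α, v j α • fderiv ℝ (f j) p (0, Pi.single α 1)
      = (1 / τ) • (feq j p - f j p)) :
    ∀ p : ℝ × (Fin d → ℝ),
      fderiv ℝ (fun p => ∑ j, h j (f j p)) p (1, 0)
        + ∑ α, fderiv ℝ (fun p => ∑ j, v j α * h j (f j p)) p (0, Pi.single α 1)
      ≤ 0 := by
  intro p
  have hcomp (j : Fin q) :
      HasFDerivAt (fun p => h j (f j p)) ((fderiv ℝ (h j) (f j p)).comp (fderiv ℝ (f j) p)) p :=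
    (hdiff j (f j p)).hasFDerivAt.comp p (hf j p).hasFDerivAt
  have hflux (α : Fin d) := (HasFDerivAt.fun_sum (u := Finset.univ)
    fun j _ => (hcomp j).const_mul (v j α)).fderiv
  have hproduction :
      fderiv ℝ (fun p => ∑ j, h j (f j p)) p (1, 0)
        + ∑ α, fderiv ℝ (fun p => ∑ j, v j α * h j (f j p)) p (0, Pi.single α 1)
      = (1 / τ) * ∑ j, fderiv ℝ (h j) (f j p) (feq j p - f j p) := by
    simp only [hflux, (HasFDerivAt.fun_sum (u := Finset.univ) fun j _ => hcomp j).fderiv,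
      sum_apply, smul_apply,
      ContinuousLinearMap.comp_apply]
    rw [Finset.sum_comm, ← Finset.sum_add_distrib, Finset.mul_sum]
    refine Finset.sum_congr rfl fun j _ => ?_
    simpa only [map_add, map_sum, map_smul, smul_eq_mul] using
      congrArg (fderiv ℝ (h j) (f j p)) (hBGK j p)
  rw [hproduction]
  refine mul_nonpos_of_nonneg_of_nonpos (by positivity) ?_
  calc ∑ j, fderiv ℝ (h j) (f j p) (feq j p - f j p)
      ≤ ∑ j, fderiv ℝ (h j) (feq j p) (feq j p - f j p) :=
        Finset.sum_le_sum fun j _ => (hconv j).fderiv_apply_sub_le (hdiff j) _ _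
    _ = ∑ j, inner ℝ (φ p) (feq j p - f j p) :=
        Finset.sum_congr rfl fun j _ => by
          rw [← hLegendre j p, inner_gradient_left]
    _ = 0 := by
        rw [← inner_sum, Finset.sum_sub_distrib, hcons, sub_self, inner_zero_right]
end

section
/- Let K, a, λ be real numbers with λ ≠ 0, and for (θ,β) ∈ ℝ² define h₀*(θ,β) := (a/2)Kθ² and h±*(θ,β) := (K/2)(θ + β²/2)²(1 ± β/λ) − (aK/4)θ². Define the equilibrium distributions as the partial derivatives f₀^eq := ∂h₀*/∂θ, f±^eq := ∂h±*/∂θ, g±^eq := ∂h±*/∂β, and set ρ := 2K(θ + β²/2), q := ρβ and p := K(θ + β²/2)². Then for all (θ,β): (i) f₀^eq + f₊^eq + f₋^eq = ρ; (ii) g₊^eq + g₋^eq = q; (iii) λ(f₊^eq − f₋^eq) = q; (iv) λ(g₊^eq − g₋^eq) = q·β + p. In particular the equilibrium fluxes of the D1Q3Q2 scheme reproduce the exact fluxes (q, q²/ρ + p) of the shallow water system. -/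
/-- The rest potential `h₀*(θ,β) = (a/2)Kθ²` of the D1Q3Q2 scheme. -/
noncomputable def h0star (K a lam : ℝ) : ℝ × ℝ → ℝ :=
  fun w => (a / 2) * K * w.1 ^ 2

/-- The potential `h₊*(θ,β) = (K/2)(θ + β²/2)²(1 + β/λ) − (aK/4)θ²`. -/
noncomputable def hplusstar (K a lam : ℝ) : ℝ × ℝ → ℝ :=
  fun w => (K / 2) * (w.1 + w.2 ^ 2 / 2) ^ 2 * (1 + w.2 / lam) - (a * K / 4) * w.1 ^ 2

/-- The potential `h₋*(θ,β) = (K/2)(θ + β²/2)²(1 − β/λ) − (aK/4)θ²`. -/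
noncomputable def hminusstar (K a lam : ℝ) : ℝ × ℝ → ℝ :=
  fun w => (K / 2) * (w.1 + w.2 ^ 2 / 2) ^ 2 * (1 - w.2 / lam) - (a * K / 4) * w.1 ^ 2

theorem fderiv_h0star_apply (K a lam θ β u v : ℝ) :
    fderiv ℝ (h0star K a lam) (θ, β) (u, v) = a * K * θ * u := by
  have h₁ : HasFDerivAt (fun w : ℝ × ℝ => w.1) (ContinuousLinearMap.fst ℝ ℝ ℝ) (θ, β) :=
    hasFDerivAt_fst
  have h : HasFDerivAt (h0star K a lam) _ (θ, β) := (h₁.pow 2).const_mul (a / 2 * K)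
  rw [h.fderiv]
  simp
  ring

theorem fderiv_hplusstar_apply (K a lam θ β u v : ℝ) :
    fderiv ℝ (hplusstar K a lam) (θ, β) (u, v)
      = K * (θ + β ^ 2 / 2) * (1 + β / lam) * (u + β * v)
        + K / 2 * (θ + β ^ 2 / 2) ^ 2 * (v / lam) - a * K / 2 * θ * u := by
  have h₁ : HasFDerivAt (fun w : ℝ × ℝ => w.1) (ContinuousLinearMap.fst ℝ ℝ ℝ) (θ, β) :=
    hasFDerivAt_fst
  have h₂ : HasFDerivAt (fun w : ℝ × ℝ => w.2) (ContinuousLinearMap.snd ℝ ℝ ℝ) (θ, β) :=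
    hasFDerivAt_snd
  have h := (((h₁.add ((h₂.pow 2).mul_const 2⁻¹)).pow 2).const_mul (K / 2)).mul
    ((h₂.mul_const lam⁻¹).const_add 1) |>.sub ((h₁.pow 2).const_mul (a * K / 4))
  have h' : HasFDerivAt (hplusstar K a lam) _ (θ, β) := h
  rw [h'.fderiv]
  simp
  ring

theorem hminusstar_eq_hplusstar_neg (K a lam : ℝ) :
    hminusstar K a lam = hplusstar K a (-lam) := by
  funext w
  simp only [hminusstar, hplusstar, div_neg, sub_eq_add_neg]

/-- The equilibrium distributions of the D1Q3Q2 vectorial lattice Boltzmann scheme for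
the one-dimensional shallow water equations with `γ = 2`, obtained as the partial
derivatives `f_j^eq = ∂h_j*/∂θ` and `g_j^eq = ∂h_j*/∂β`, reproduce the conserved
moments `ρ = 2K(θ + β²/2)`, `q = ρβ` and the exact fluxes `q` and `q·β + p = q²/ρ + p`
of the shallow water system, where `p = K(θ + β²/2)²`. -/
theorem d1q3q2_equilibria (K a lam : ℝ) (hlam : lam ≠ 0) :
    ∀ θ β : ℝ,
      fderiv ℝ (h0star K a lam) (θ, β) (1, 0)
        + fderiv ℝ (hplusstar K a lam) (θ, β) (1, 0)
        + fderiv ℝ (hminusstar K a lam) (θ, β) (1, 0)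
        = 2 * K * (θ + β ^ 2 / 2) ∧
      fderiv ℝ (hplusstar K a lam) (θ, β) (0, 1)
        + fderiv ℝ (hminusstar K a lam) (θ, β) (0, 1)
        = 2 * K * (θ + β ^ 2 / 2) * β ∧
      lam * (fderiv ℝ (hplusstar K a lam) (θ, β) (1, 0)
        - fderiv ℝ (hminusstar K a lam) (θ, β) (1, 0))
        = 2 * K * (θ + β ^ 2 / 2) * β ∧
      lam * (fderiv ℝ (hplusstar K a lam) (θ, β) (0, 1)
        - fderiv ℝ (hminusstar K a lam) (θ, β) (0, 1))
        = 2 * K * (θ + β ^ 2 / 2) * β * β + K * (θ + β ^ 2 / 2) ^ 2 := by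
  intro θ β
  simp only [hminusstar_eq_hplusstar_neg, fderiv_h0star_apply, fderiv_hplusstar_apply]
  refine ⟨?_, ?_, ?_, ?_⟩ <;> field_simp <;> ring
end

section
/- Let λ ≠ 0, ρ₀ > 0, c₀ > 0 and a ∈ ℝ. For (θ, u, v) ∈ ℝ³ define P(θ,u,v) := (ρ₀/(2c₀²))(θ + (u²+v²)/2)², h₀*(θ) := (a/2)(ρ₀/(2c₀²))θ², and h₁* := (P − h₀*)/4 + Pu/(2λ), h₃* := (P − h₀*)/4 − Pu/(2λ), h₂* := (P − h₀*)/4 + Pv/(2λ), h₄* := (P − h₀*)/4 − Pv/(2λ). Define the equilibrium distributions f_j^eq := ∂h_j*/∂θ (0 ≤ j ≤ 4), g_{x,j}^eq := ∂h_j*/∂u and g_{y,j}^eq := ∂h_j*/∂v (1 ≤ j ≤ 4), and set ρ := ∂P/∂θ = (ρ₀/c₀²)(θ + (u²+v²)/2). Then for all (θ,u,v): (i) Σ_{j=0}^{4} f_j^eq = ρ; (ii) Σ_{j=1}^{4} g_{x,j}^eq = ρu and Σ_{j=1}^{4} g_{y,j}^eq = ρv; (iii) λ(f₁^eq − f₃^eq)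 = ρu and λ(f₂^eq − f₄^eq) = ρv; (iv) λ(g_{x,1}^eq − g_{x,3}^eq) = ρu² + P and λ(g_{x,2}^eq − g_{x,4}^eq) = ρuv; (v) λ(g_{y,1}^eq − g_{y,3}^eq) = ρuv and λ(g_{y,2}^eq − g_{y,4}^eq) = ρv² + P. -/
/-- The dual entropy `P(θ,u,v) = (ρ₀/(2c₀²))(θ + (u²+v²)/2)²` of the two-dimensional
shallow water system with `γ = 2`, as a function of the entropy variables. -/
noncomputable def swP (ρ₀ c₀ : ℝ) : ℝ × ℝ × ℝ → ℝ :=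
  fun w => (ρ₀ / (2 * c₀ ^ 2)) * (w.1 + (w.2.1 ^ 2 + w.2.2 ^ 2) / 2) ^ 2

/-- The rest potential `h₀*(θ) = (a/2)(ρ₀/(2c₀²))θ²`. -/
noncomputable def swH0 (ρ₀ c₀ a : ℝ) : ℝ × ℝ × ℝ → ℝ :=
  fun w => (a / 2) * (ρ₀ / (2 * c₀ ^ 2)) * w.1 ^ 2

/-- The potential `h₁* = (P − h₀*)/4 + Pu/(2λ)`. -/
noncomputable def swH1 (ρ₀ c₀ a lam : ℝ) : ℝ × ℝ × ℝ → ℝ :=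
  fun w => (swP ρ₀ c₀ w - swH0 ρ₀ c₀ a w) / 4 + swP ρ₀ c₀ w * w.2.1 / (2 * lam)

/-- The potential `h₂* = (P − h₀*)/4 + Pv/(2λ)`. -/
noncomputable def swH2 (ρ₀ c₀ a lam : ℝ) : ℝ × ℝ × ℝ → ℝ :=
  fun w => (swP ρ₀ c₀ w - swH0 ρ₀ c₀ a w) / 4 + swP ρ₀ c₀ w * w.2.2 / (2 * lam)

/-- The potential `h₃* = (P − h₀*)/4 − Pu/(2λ)`. -/
noncomputable def swH3 (ρ₀ c₀ a lam : ℝ) : ℝ × ℝ × ℝ → ℝ :=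
  fun w => (swP ρ₀ c₀ w - swH0 ρ₀ c₀ a w) / 4 - swP ρ₀ c₀ w * w.2.1 / (2 * lam)

/-- The potential `h₄* = (P − h₀*)/4 − Pv/(2λ)`. -/
noncomputable def swH4 (ρ₀ c₀ a lam : ℝ) : ℝ × ℝ × ℝ → ℝ :=
  fun w => (swP ρ₀ c₀ w - swH0 ρ₀ c₀ a w) / 4 - swP ρ₀ c₀ w * w.2.2 / (2 * lam)

theorem hasFDerivAt_swP (ρ₀ c₀ : ℝ) (w : ℝ × ℝ × ℝ) :
    HasFDerivAt (swP ρ₀ c₀) (fderiv ℝ (swP ρ₀ c₀) w) w := by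
  refine DifferentiableAt.hasFDerivAt ?_
  unfold swP
  fun_prop

theorem hasFDerivAt_swH0 (ρ₀ c₀ a : ℝ) (w : ℝ × ℝ × ℝ) :
    HasFDerivAt (swH0 ρ₀ c₀ a) (fderiv ℝ (swH0 ρ₀ c₀ a) w) w := by
  refine DifferentiableAt.hasFDerivAt ?_
  unfold swH0
  fun_prop

theorem fderiv_swP_apply (ρ₀ c₀ : ℝ) (w d : ℝ × ℝ × ℝ) :
    fderiv ℝ (swP ρ₀ c₀) w d = (ρ₀ / c₀ ^ 2) * (w.1 + (w.2.1 ^ 2 + w.2.2 ^ 2) / 2) *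
      (d.1 + w.2.1 * d.2.1 + w.2.2 * d.2.2) := by
  have h1 : HasFDerivAt (fun w : ℝ × ℝ × ℝ => w.1) _ w := hasFDerivAt_fst (𝕜 := ℝ)
  have h2 : HasFDerivAt (fun w : ℝ × ℝ × ℝ => w.2.1) _ w :=
    (hasFDerivAt_snd (𝕜 := ℝ)).fst
  have h3 : HasFDerivAt (fun w : ℝ × ℝ × ℝ => w.2.2) _ w :=
    (hasFDerivAt_snd (𝕜 := ℝ)).snd
  have h : HasFDerivAt (swP ρ₀ c₀) _ w :=
    ((h1.add (((h2.pow 2).add (h3.pow 2)).mul_const (2⁻¹ : ℝ))).pow 2).const_mul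
      (ρ₀ / (2 * c₀ ^ 2))
  rw [h.fderiv]
  simp
  ring

theorem fderiv_add_mul_clm_apply {E : Type*} [NormedAddCommGroup E] [NormedSpace ℝ E]
    {P H : E → ℝ} {P' H' : E →L[ℝ] ℝ} {w : E} (hP : HasFDerivAt P P' w)
    (hH : HasFDerivAt H H' w) (L : E →L[ℝ] ℝ) (r : ℝ) (d : E) :
    fderiv ℝ (fun w => (P w - H w) / 4 + P w * L w / r) w d =
      (P' d - H' d) / 4 + (P' d * L w + P w * L d) / r := by
  have h := ((hP.sub hH).mul_const (4⁻¹ : ℝ)).add ((hP.mul L.hasFDerivAt).mul_const r⁻¹)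
  have h' : HasFDerivAt (fun w => (P w - H w) / 4 + P w * L w / r) _ w := h
  rw [h'.fderiv]
  simp
  ring

theorem fderiv_sub_mul_clm_apply {E : Type*} [NormedAddCommGroup E] [NormedSpace ℝ E]
    {P H : E → ℝ} {P' H' : E →L[ℝ] ℝ} {w : E} (hP : HasFDerivAt P P' w)
    (hH : HasFDerivAt H H' w) (L : E →L[ℝ] ℝ) (r : ℝ) (d : E) :
    fderiv ℝ (fun w => (P w - H w) / 4 - P w * L w / r) w d =
      (P' d - H' d) / 4 - (P' d * L w + P w * L d) / r := by
  have h := fderiv_add_mul_clm_apply hP hH L (-r) d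
  simpa only [div_neg, ← sub_eq_add_neg] using h

theorem fderiv_swH1_apply (ρ₀ c₀ a lam : ℝ) (w d : ℝ × ℝ × ℝ) :
    fderiv ℝ (swH1 ρ₀ c₀ a lam) w d =
      (fderiv ℝ (swP ρ₀ c₀) w d - fderiv ℝ (swH0 ρ₀ c₀ a) w d) / 4 +
        (fderiv ℝ (swP ρ₀ c₀) w d * w.2.1 + swP ρ₀ c₀ w * d.2.1) / (2 * lam) :=
  fderiv_add_mul_clm_apply (hasFDerivAt_swP ρ₀ c₀ w) (hasFDerivAt_swH0 ρ₀ c₀ a w)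
    ((ContinuousLinearMap.fst ℝ ℝ ℝ).comp (ContinuousLinearMap.snd ℝ ℝ (ℝ × ℝ))) (2 * lam) d

theorem fderiv_swH2_apply (ρ₀ c₀ a lam : ℝ) (w d : ℝ × ℝ × ℝ) :
    fderiv ℝ (swH2 ρ₀ c₀ a lam) w d =
      (fderiv ℝ (swP ρ₀ c₀) w d - fderiv ℝ (swH0 ρ₀ c₀ a) w d) / 4 +
        (fderiv ℝ (swP ρ₀ c₀) w d * w.2.2 + swP ρ₀ c₀ w * d.2.2) / (2 * lam) :=
  fderiv_add_mul_clm_apply (hasFDerivAt_swP ρ₀ c₀ w) (hasFDerivAt_swH0 ρ₀ c₀ a w)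
    ((ContinuousLinearMap.snd ℝ ℝ ℝ).comp (ContinuousLinearMap.snd ℝ ℝ (ℝ × ℝ))) (2 * lam) d

theorem fderiv_swH3_apply (ρ₀ c₀ a lam : ℝ) (w d : ℝ × ℝ × ℝ) :
    fderiv ℝ (swH3 ρ₀ c₀ a lam) w d =
      (fderiv ℝ (swP ρ₀ c₀) w d - fderiv ℝ (swH0 ρ₀ c₀ a) w d) / 4 -
        (fderiv ℝ (swP ρ₀ c₀) w d * w.2.1 + swP ρ₀ c₀ w * d.2.1) / (2 * lam) :=
  fderiv_sub_mul_clm_apply (hasFDerivAt_swP ρ₀ c₀ w) (hasFDerivAt_swH0 ρ₀ c₀ a w)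
    ((ContinuousLinearMap.fst ℝ ℝ ℝ).comp (ContinuousLinearMap.snd ℝ ℝ (ℝ × ℝ))) (2 * lam) d

theorem fderiv_swH4_apply (ρ₀ c₀ a lam : ℝ) (w d : ℝ × ℝ × ℝ) :
    fderiv ℝ (swH4 ρ₀ c₀ a lam) w d =
      (fderiv ℝ (swP ρ₀ c₀) w d - fderiv ℝ (swH0 ρ₀ c₀ a) w d) / 4 -
        (fderiv ℝ (swP ρ₀ c₀) w d * w.2.2 + swP ρ₀ c₀ w * d.2.2) / (2 * lam) :=
  fderiv_sub_mul_clm_apply (hasFDerivAt_swP ρ₀ c₀ w) (hasFDerivAt_swH0 ρ₀ c₀ a w)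
    ((ContinuousLinearMap.snd ℝ ℝ ℝ).comp (ContinuousLinearMap.snd ℝ ℝ (ℝ × ℝ))) (2 * lam) d

theorem fderiv_swH0_apply_of_fst_eq_zero (ρ₀ c₀ a : ℝ) (w d : ℝ × ℝ × ℝ) (hd : d.1 = 0) :
    fderiv ℝ (swH0 ρ₀ c₀ a) w d = 0 := by
  have h1 : HasFDerivAt (fun w : ℝ × ℝ × ℝ => w.1) _ w := hasFDerivAt_fst (𝕜 := ℝ)
  have h : HasFDerivAt (swH0 ρ₀ c₀ a) _ w :=
    (h1.pow 2).const_mul ((a / 2) * (ρ₀ / (2 * c₀ ^ 2)))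
  rw [h.fderiv]
  simp [hd]

/-- The equilibrium distributions of the D2Q5Q4Q4 vectorial lattice Boltzmann scheme,
obtained as the partial derivatives `f_j^eq = ∂h_j*/∂θ`, `g_{x,j}^eq = ∂h_j*/∂u`,
`g_{y,j}^eq = ∂h_j*/∂v`, reproduce the conserved quantities `(ρ, ρu, ρv)` and the exact
fluxes `(ρu, ρu² + P, ρuv)` and `(ρv, ρuv, ρv² + P)` of the two-dimensional shallow
water system, where `ρ = ∂P/∂θ = (ρ₀/c₀²)(θ + (u²+v²)/2)`. -/
theorem d2q5q4q4_equilibria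
    (ρ₀ c₀ a lam : ℝ) (hρ₀ : 0 < ρ₀) (hc₀ : 0 < c₀) (hlam : lam ≠ 0) :
    ∀ θ u v : ℝ,
      -- (i) mass: Σ_j f_j^eq = ρ
      (fderiv ℝ (swH0 ρ₀ c₀ a) (θ, u, v) (1, 0, 0)
        + fderiv ℝ (swH1 ρ₀ c₀ a lam) (θ, u, v) (1, 0, 0)
        + fderiv ℝ (swH2 ρ₀ c₀ a lam) (θ, u, v) (1, 0, 0)
        + fderiv ℝ (swH3 ρ₀ c₀ a lam) (θ, u, v) (1, 0, 0)
        + fderiv ℝ (swH4 ρ₀ c₀ a lam) (θ, u, v) (1, 0, 0)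
        = (ρ₀ / c₀ ^ 2) * (θ + (u ^ 2 + v ^ 2) / 2)) ∧
      -- (ii) momenta: Σ_j g_{x,j}^eq = ρu and Σ_j g_{y,j}^eq = ρv
      (fderiv ℝ (swH1 ρ₀ c₀ a lam) (θ, u, v) (0, 1, 0)
        + fderiv ℝ (swH2 ρ₀ c₀ a lam) (θ, u, v) (0, 1, 0)
        + fderiv ℝ (swH3 ρ₀ c₀ a lam) (θ, u, v) (0, 1, 0)
        + fderiv ℝ (swH4 ρ₀ c₀ a lam) (θ, u, v) (0, 1, 0)
        = (ρ₀ / c₀ ^ 2) * (θ + (u ^ 2 + v ^ 2) / 2) * u) ∧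
      (fderiv ℝ (swH1 ρ₀ c₀ a lam) (θ, u, v) (0, 0, 1)
        + fderiv ℝ (swH2 ρ₀ c₀ a lam) (θ, u, v) (0, 0, 1)
        + fderiv ℝ (swH3 ρ₀ c₀ a lam) (θ, u, v) (0, 0, 1)
        + fderiv ℝ (swH4 ρ₀ c₀ a lam) (θ, u, v) (0, 0, 1)
        = (ρ₀ / c₀ ^ 2) * (θ + (u ^ 2 + v ^ 2) / 2) * v) ∧
      -- (iii) mass fluxes: λ(f₁ − f₃) = ρu and λ(f₂ − f₄) = ρv
      (lam * (fderiv ℝ (swH1 ρ₀ c₀ a lam) (θ, u, v) (1, 0, 0)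
          - fderiv ℝ (swH3 ρ₀ c₀ a lam) (θ, u, v) (1, 0, 0))
        = (ρ₀ / c₀ ^ 2) * (θ + (u ^ 2 + v ^ 2) / 2) * u) ∧
      (lam * (fderiv ℝ (swH2 ρ₀ c₀ a lam) (θ, u, v) (1, 0, 0)
          - fderiv ℝ (swH4 ρ₀ c₀ a lam) (θ, u, v) (1, 0, 0))
        = (ρ₀ / c₀ ^ 2) * (θ + (u ^ 2 + v ^ 2) / 2) * v) ∧
      -- (iv) x-momentum fluxes: λ(g_{x,1} − g_{x,3}) = ρu² + P and λ(g_{x,2} − g_{x,4}) = ρuv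
      (lam * (fderiv ℝ (swH1 ρ₀ c₀ a lam) (θ, u, v) (0, 1, 0)
          - fderiv ℝ (swH3 ρ₀ c₀ a lam) (θ, u, v) (0, 1, 0))
        = (ρ₀ / c₀ ^ 2) * (θ + (u ^ 2 + v ^ 2) / 2) * u ^ 2 + swP ρ₀ c₀ (θ, u, v)) ∧
      (lam * (fderiv ℝ (swH2 ρ₀ c₀ a lam) (θ, u, v) (0, 1, 0)
          - fderiv ℝ (swH4 ρ₀ c₀ a lam) (θ, u, v) (0, 1, 0))
        = (ρ₀ / c₀ ^ 2) * (θ + (u ^ 2 + v ^ 2) / 2) * u * v) ∧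
      -- (v) y-momentum fluxes: λ(g_{y,1} − g_{y,3}) = ρuv and λ(g_{y,2} − g_{y,4}) = ρv² + P
      (lam * (fderiv ℝ (swH1 ρ₀ c₀ a lam) (θ, u, v) (0, 0, 1)
          - fderiv ℝ (swH3 ρ₀ c₀ a lam) (θ, u, v) (0, 0, 1))
        = (ρ₀ / c₀ ^ 2) * (θ + (u ^ 2 + v ^ 2) / 2) * u * v) ∧
      (lam * (fderiv ℝ (swH2 ρ₀ c₀ a lam) (θ, u, v) (0, 0, 1)
          - fderiv ℝ (swH4 ρ₀ c₀ a lam) (θ, u, v) (0, 0, 1))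
        = (ρ₀ / c₀ ^ 2) * (θ + (u ^ 2 + v ^ 2) / 2) * v ^ 2 + swP ρ₀ c₀ (θ, u, v)) := by
  intro θ u v
  have hx := fderiv_swH0_apply_of_fst_eq_zero ρ₀ c₀ a (θ, u, v) (0, 1, 0) rfl
  have hy := fderiv_swH0_apply_of_fst_eq_zero ρ₀ c₀ a (θ, u, v) (0, 0, 1) rfl
  simp only [fderiv_swH1_apply, fderiv_swH2_apply, fderiv_swH3_apply, fderiv_swH4_apply,
    fderiv_swP_apply, hx, hy]
  refine ⟨?_, ?_, ?_, ?_, ?_, ?_, ?_, ?_, ?_⟩ <;> field_simp <;> ring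
end
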